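/- Under the convergence condition, let z ∈ ℂ₀^λ be a zero of F_𝒥. Then ∑_{n∈ℤ} f_n(z)² = A(z)·F_𝒥'(z), where A(z) = w_{n−1} P_n(z) P_{n−1}(z) · 𝔉((γ_k²/(λ_k−z))_{k=n+1}^∞) / 𝔉((γ_k²/(λ_k−z))_{k=−∞}^{n−1}) for an arbitrary n ∈ ℤ such that the denominator does not vanish (and for every n ∈ ℤ, at least one of the denominators at n and at n+1 is nonzero). -/

import Mathlib

open Filter Topology
open scoped Classical

noncomputable section

namespace Jacobi

/-- Admissible index tuples `k : Fin (m+1) → ℤ` with gaps `≥ 2` (an `(m+1)`-tuple,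
corresponding to the `m`-th summand, `m ≥ 1`, in the paper). -/
def Tup (m : ℕ) : Type :=
  {k : Fin (m + 1) → ℤ // ∀ j : Fin m, k j.castSucc + 2 ≤ k j.succ}

/-- The function `𝔉` of Stampach--Stovicek. -/
def FF (x : ℤ → ℂ) : ℂ :=
  1 + ∑' m : ℕ, (-1 : ℂ) ^ (m + 1) * ∑' k : Tup m, ∏ j, x (k.1 j) * x (k.1 j + 1)

/-- `𝔉` applied to the restriction of `x` to `s` (extension by zeros). -/
def FFon (s : Set ℤ) (x : ℤ → ℂ) : ℂ := FF (s.indicator x)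

/-- `ℂ₀^λ`. -/
def C0 (lam : ℤ → ℂ) : Set ℂ := (closure (Set.range lam))ᶜ

/-- `der λ`: the set of (finite) accumulation points of the sequence `λ`. -/
def der (lam : ℤ → ℂ) : Set ℂ := {z | MapClusterPt z Filter.cofinite lam}

/-- The basic convergence condition (at one point of `ℂ₀^λ`). -/
def ConvCond (lam w : ℤ → ℂ) : Prop :=
  ∃ z₀ ∈ C0 lam, Summable fun n : ℤ => ‖w n ^ 2 / ((lam n - z₀) * (lam (n + 1) - z₀))‖

/-- The characteristic function `F_𝒥`. -/
def charF (lam γ : ℤ → ℂ) (z : ℂ) : ℂ := FF fun n => γ n ^ 2 / (z - lam n)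

/-- `r(z)`. -/
def rz (lam : ℤ → ℂ) (z : ℂ) : ℕ := Set.ncard {n : ℤ | lam n = z}

/-- `r₊(z)`. -/
def rp (lam : ℤ → ℂ) (z : ℂ) : ℕ := Set.ncard {n : ℤ | 0 < n ∧ lam n = z}

/-- `r₋(z)`. -/
def rm (lam : ℤ → ℂ) (z : ℂ) : ℕ := Set.ncard {n : ℤ | n ≤ 0 ∧ lam n = z}

/-- `𝒫_n(z)`. -/
def Pz (lam w : ℤ → ℂ) (z : ℂ) (n : ℤ) : ℂ :=
  if 0 ≤ n then ∏ k ∈ Finset.Icc (1 : ℤ) n, w (k - 1) / (z - lam k)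
  else ∏ k ∈ Finset.Icc (n + 1) (0 : ℤ), (z - lam k) / w (k - 1)

/-- `𝔉((γ_k²/(λ_k − z))_{k=n}^{∞})`. -/
def Fplus (lam γ : ℤ → ℂ) (z : ℂ) (n : ℤ) : ℂ :=
  FFon {k | n ≤ k} fun k => γ k ^ 2 / (lam k - z)

/-- `𝔉((γ_k²/(λ_k − z))_{k=−∞}^{n})`. -/
def Fminus (lam γ : ℤ → ℂ) (z : ℂ) (n : ℤ) : ℂ :=
  FFon {k | k ≤ n} fun k => γ k ^ 2 / (lam k - z)

/-- `f_n(z)` for `z ∈ ℂ₀^λ`. -/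
def fSol₀ (lam w γ : ℤ → ℂ) (z : ℂ) (n : ℤ) : ℂ :=
  Pz lam w z n * Fplus lam γ z (n + 1)

/-- `g_n(z)` for `z ∈ ℂ₀^λ`. -/
def gSol₀ (lam w γ : ℤ → ℂ) (z : ℂ) (n : ℤ) : ℂ :=
  (w (n - 1) * Pz lam w z (n - 1))⁻¹ * Fminus lam γ z (n - 1)

/-- `f_n(z)` extended to `ℂ ∖ der λ` by the limit formula. -/
def fSol (lam w γ : ℤ → ℂ) (z : ℂ) (n : ℤ) : ℂ :=
  if z ∈ C0 lam then fSol₀ lam w γ z n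
  else limUnder (𝓝[C0 lam] z) fun u => (u - z) ^ rp lam z * fSol₀ lam w γ u n

/-- `g_n(z)` extended to `ℂ ∖ der λ` by the limit formula. -/
def gSol (lam w γ : ℤ → ℂ) (z : ℂ) (n : ℤ) : ℂ :=
  if z ∈ C0 lam then gSol₀ lam w γ z n
  else limUnder (𝓝[C0 lam] z) fun u => (u - z) ^ rm lam z * gSol₀ lam w γ u n

/-- The extended zero set `𝔷(𝒥)` of the characteristic function. -/
def Zset (lam w γ : ℤ → ℂ) : Set ℂ :=
  {z | z ∉ der lam ∧
    Tendsto (fun u => (u - z) ^ rz lam z * charF lam γ u) (𝓝[C0 lam] z) (𝓝 0)}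

/-- The Hilbert space `ℓ²(ℤ)`. -/
abbrev ℓ2 : Type := lp (fun _ : ℤ => ℂ) 2

/-- The formal Jacobi matrix acting on sequences. -/
def Jop (lam w : ℤ → ℂ) (u : ℤ → ℂ) : ℤ → ℂ := fun n =>
  w (n - 1) * u (n - 1) + lam n * u n + w n * u (n + 1)

lemma Jop_add (lam w : ℤ → ℂ) (u v : ℤ → ℂ) :
    Jop lam w (u + v) = Jop lam w u + Jop lam w v := by
  funext n; simp [Jop]; ring

lemma Jop_smul (lam w : ℤ → ℂ) (c : ℂ) (u : ℤ → ℂ) :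
    Jop lam w (c • u) = c • Jop lam w u := by
  funext n; simp [Jop]; ring

/-- The domain of the maximal operator. -/
def JmaxDom (lam w : ℤ → ℂ) : Submodule ℂ ℓ2 where
  carrier := {x | Memℓp (Jop lam w ⇑x) 2}
  add_mem' := by
    intro x y hx hy
    show Memℓp (Jop lam w ⇑(x + y)) 2
    rw [lp.coeFn_add, Jop_add]
    exact hx.add hy
  zero_mem' := by
    show Memℓp (Jop lam w ⇑(0 : ℓ2)) 2
    have h0 : Jop lam w ⇑(0 : ℓ2) = 0 := by
      funext n; simp [Jop, lp.coeFn_zero]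
    rw [h0]
    exact zero_memℓp
  smul_mem' := by
    intro c x hx
    show Memℓp (Jop lam w ⇑(c • x)) 2
    rw [lp.coeFn_smul, Jop_smul]
    exact hx.const_smul c

/-- The maximal operator `J_max` as a partially defined linear operator on `ℓ²(ℤ)`. -/
def Jmax (lam w : ℤ → ℂ) : ℓ2 →ₗ.[ℂ] ℓ2 where
  domain := JmaxDom lam w
  toFun :=
    { toFun := fun x => (⟨Jop lam w ⇑(x : ℓ2), x.2⟩ : ℓ2)
      map_add' := by
        intro x y
        apply lp.ext
        rw [lp.coeFn_add]
        show Jop lam w ⇑((x : ℓ2) + (y : ℓ2)) = Jop lam w ⇑(x : ℓ2) + Jop lam w ⇑(y : ℓ2)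
        rw [lp.coeFn_add, Jop_add]
      map_smul' := by
        intro c x
        apply lp.ext
        rw [lp.coeFn_smul]
        show Jop lam w ⇑(c • (x : ℓ2)) = c • Jop lam w ⇑(x : ℓ2)
        rw [lp.coeFn_smul, Jop_smul] }

/-- The standard basis vector `e n` in `ℓ²(ℤ)`. -/
def eVec (n : ℤ) : ℓ2 := lp.single 2 n (1 : ℂ)

/-- The span of the standard basis vectors. -/
def stdSpan : Submodule ℂ ℓ2 := Submodule.span ℂ (Set.range eVec)

/-- The minimal operator `J_min`: the closure of the restriction of `𝒥` to the span of the
standard basis. -/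
def Jmin (lam w : ℤ → ℂ) : ℓ2 →ₗ.[ℂ] ℓ2 :=
  ((Jmax lam w).domRestrict stdSpan).closure

/-- `z` is an eigenvalue of the partially defined operator `T`. -/
def IsEV (T : ℓ2 →ₗ.[ℂ] ℓ2) (z : ℂ) : Prop :=
  ∃ x : T.domain, (x : ℓ2) ≠ 0 ∧ T x = z • (x : ℓ2)

/-- `z` belongs to the resolvent set of `T`: `T - z` is a bijection of `Dom T` onto `ℓ²(ℤ)`
with bounded (continuous linear) inverse. -/
def InRes (T : ℓ2 →ₗ.[ℂ] ℓ2) (z : ℂ) : Prop :=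
  ∃ R : ℓ2 →L[ℂ] ℓ2,
    (∀ x : T.domain, R (T x - z • (x : ℓ2)) = x) ∧
    ∀ y : ℓ2, ∃ hy : R y ∈ T.domain, T ⟨R y, hy⟩ - z • (R y) = y

/-- The spectrum of a partially defined operator. -/
def Spec (T : ℓ2 →ₗ.[ℂ] ℓ2) : Set ℂ := {z | ¬ InRes T z}

/-- `Ker (T - z)^n`. -/
def iterKer (T : ℓ2 →ₗ.[ℂ] ℓ2) (z : ℂ) : ℕ → Set ℓ2
  | 0 => {0}
  | n + 1 => {x | ∃ hx : x ∈ T.domain, ((T ⟨x, hx⟩ : ℓ2) - z • x) ∈ iterKer T z n}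

/-- The set of generalized eigenvectors of `T` at `z`. -/
def genEig (T : ℓ2 →ₗ.[ℂ] ℓ2) (z : ℂ) : Set ℓ2 :=
  {x | ∃ n : ℕ, x ∈ iterKer T z n}

/-- `Φ_p^+`. -/
def PhiP (lam : ℤ → ℂ) (p : ℕ) (z : ℂ) : ℂ :=
  ∏' n : ℕ, ((1 - lam ((n : ℤ) + 1) / z) *
    Complex.exp (∑ j ∈ Finset.Icc 1 (p - 1), (lam ((n : ℤ) + 1) / z) ^ j / (j : ℂ)))

/-- `Φ_p^-`. -/
def PhiM (lam : ℤ → ℂ) (p : ℕ) (z : ℂ) : ℂ :=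
  ∏' n : ℕ, ((1 - lam (-(n : ℤ)) / z) *
    Complex.exp (∑ j ∈ Finset.Icc 1 (p - 1), (lam (-(n : ℤ)) / z) ^ j / (j : ℂ)))

/-- `Ψ_p^+`. -/
def PsiP (lam : ℤ → ℂ) (p : ℕ) (z : ℂ) : ℂ :=
  ∏' n : ℕ, ((1 - z / lam ((n : ℤ) + 1)) *
    Complex.exp (∑ j ∈ Finset.Icc 1 (p - 1), (z / lam ((n : ℤ) + 1)) ^ j / (j : ℂ)))

/-- `Ψ_p^-`. -/
def PsiM (lam : ℤ → ℂ) (p : ℕ) (z : ℂ) : ℂ :=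
  ∏' n : ℕ, ((1 - z / lam (-(n : ℤ))) *
    Complex.exp (∑ j ∈ Finset.Icc 1 (p - 1), (z / lam (-(n : ℤ))) ^ j / (j : ℂ)))

end Jacobi

namespace Jacobi

/-- No two consecutive integers. -/
def Adm (S : Finset ℤ) : Prop := ∀ k ∈ S, k + 1 ∉ S

/-- Signed weight of an admissible set. -/
def TT (y : ℤ → ℂ) (S : Finset ℤ) : ℂ := if Adm S then ∏ k ∈ S, -y k else 0

/-- The function `𝔉` as a sum over finite admissible sets. -/
def GG (y : ℤ → ℂ) : ℂ := ∑' S : Finset ℤ, TT y S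

lemma norm_TT_le (y : ℤ → ℂ) (b : ℤ → ℝ) (h : ∀ k, ‖y k‖ ≤ b k) (S : Finset ℤ) :
    ‖TT y S‖ ≤ ∏ k ∈ S, b k := by
  unfold TT
  split_ifs
  · rw [norm_prod]
    refine Finset.prod_le_prod (fun _ _ => norm_nonneg _) (fun k _ => ?_)
    rw [norm_neg]; exact h k
  · rw [norm_zero]
    exact Finset.prod_nonneg (fun k _ => (norm_nonneg _).trans (h k))

lemma summable_norm_TT {y : ℤ → ℂ} (hy : Summable fun k => ‖y k‖) :
    Summable fun S => ‖TT y S‖ :=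
  Summable.of_nonneg_of_le (fun _ => norm_nonneg _) (norm_TT_le y _ (fun _ => le_rfl))
    (summable_finsetProd_of_summable_nonneg (fun _ => norm_nonneg _) hy)

lemma hasSum_TT {y : ℤ → ℂ} (hy : Summable fun k => ‖y k‖) : HasSum (TT y) (GG y) :=
  (summable_norm_TT hy).of_norm.hasSum

lemma TT_zero_of_mem {y : ℤ → ℂ} {S : Finset ℤ} {k : ℤ} (hk : k ∈ S) (h : y k = 0) :
    TT y S = 0 := by
  unfold TT
  split_ifs
  · exact Finset.prod_eq_zero hk (by simp [h])
  · rfl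

lemma TT_congr {y y' : ℤ → ℂ} {S : Finset ℤ} (h : ∀ k ∈ S, y k = y' k) : TT y S = TT y' S := by
  unfold TT
  rw [Finset.prod_congr rfl (fun k hk => by rw [h k hk])]

lemma TT_empty (y : ℤ → ℂ) : TT y ∅ = 1 := by
  simp [TT, Adm]

lemma summable_ind {y : ℤ → ℂ} (hy : Summable fun k => ‖y k‖) (s : Set ℤ) :
    Summable fun k => ‖s.indicator y k‖ :=
  Summable.of_nonneg_of_le (fun _ => norm_nonneg _) (fun k => norm_indicator_le_norm_self y k) hy

lemma Tup_strictMono {m : ℕ} (k : Tup m) : StrictMono k.1 := by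
  rw [Fin.strictMono_iff_lt_succ]
  intro i
  have := k.2 i
  omega

/-- index set -/
def phi (p : Σ m, Tup m) : Finset ℤ := Finset.univ.map ⟨p.2.1, (Tup_strictMono p.2).injective⟩

lemma phi_card (p : Σ m, Tup m) : (phi p).card = p.1 + 1 := by simp [phi]

lemma phi_inj : Function.Injective phi := by
  rintro ⟨m, k⟩ ⟨m', k'⟩ h
  have hm : m = m' := by
    have h1 := phi_card ⟨m, k⟩
    have h2 := phi_card ⟨m', k'⟩
    rw [h, h2] at h1
    simpa using h1.symm
  subst hm
  have hk : k = k' := by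
    apply Subtype.ext
    have e1 := Finset.orderEmbOfFin_unique (phi_card ⟨m, k⟩) (f := k.1)
      (fun x => by simp [phi]) (Tup_strictMono k)
    have e2 := Finset.orderEmbOfFin_unique (phi_card ⟨m, k⟩) (f := k'.1)
      (fun x => by rw [h]; simp [phi]) (Tup_strictMono k')
    rw [e1, e2]
  rw [hk]

lemma phi_adm (p : Σ m, Tup m) : Adm (phi p) := by
  obtain ⟨m, k⟩ := p
  intro a ha hb
  simp only [phi, Finset.mem_map, Finset.mem_univ, true_and, Function.Embedding.coeFn_mk] at ha hb
  obtain ⟨i, rfl⟩ := ha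
  obtain ⟨j, hj⟩ := hb
  have hij : i < j := by
    rw [← (Tup_strictMono k).lt_iff_lt]; omega
  obtain ⟨i', rfl⟩ : ∃ i' : Fin m, i = i'.castSucc :=
    ⟨⟨i.1, by have := hij; have := j.2; omega⟩, by ext; simp⟩
  have h1 := k.2 i'
  have h2 : k.1 i'.succ ≤ k.1 j := (Tup_strictMono k).monotone (by
    rw [Fin.le_def]; rw [Fin.lt_def] at hij; simp at hij ⊢; omega)
  omega

lemma phi_surj (S : Finset ℤ) (hS : Adm S) (hne : S ≠ ∅) : ∃ p, phi p = S := by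
  obtain ⟨m, hm⟩ : ∃ m, S.card = m + 1 :=
    Nat.exists_eq_succ_of_ne_zero (by simpa using hne)
  refine ⟨⟨m, ⟨S.orderEmbOfFin hm, ?_⟩⟩, ?_⟩
  · intro j
    have h1 : S.orderEmbOfFin hm j.castSucc < S.orderEmbOfFin hm j.succ := by
      simp [Fin.lt_def]
    have h2 := hS _ (Finset.orderEmbOfFin_mem S hm j.castSucc)
    have h3 := Finset.orderEmbOfFin_mem S hm j.succ
    by_contra hcon
    apply h2
    convert h3 using 1
    omega
  · ext a
    have := Set.ext_iff.mp (Finset.range_orderEmbOfFin S hm) a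
    rw [Set.mem_range, Finset.mem_coe] at this
    simpa only [phi, Finset.mem_map, Finset.mem_univ, true_and, Function.Embedding.coeFn_mk] using this

lemma TT_phi (y : ℤ → ℂ) (m : ℕ) (k : Tup m) :
    TT y (phi ⟨m, k⟩) = (-1 : ℂ) ^ (m + 1) * ∏ j, y (k.1 j) := by
  unfold TT
  rw [if_pos (phi_adm _)]
  simp [phi, Finset.prod_neg]

lemma FF_eq_GG (x y : ℤ → ℂ) (hxy : ∀ k, x k * x (k + 1) = y k)
    (hy : Summable fun k => ‖y k‖) : FF x = GG y := by
  have h1 : HasSum (fun S => TT y S - if S = ∅ then 1 else 0) (GG y - 1) :=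
    (hasSum_TT hy).sub (hasSum_ite_eq ∅ 1)
  rw [← phi_inj.hasSum_iff] at h1
  · have h2 : ∀ p : Σ m, Tup m,
        ((fun S => TT y S - if S = ∅ then 1 else 0) ∘ phi) p = TT y (phi p) := by
      intro p
      have : phi p ≠ ∅ := by
        intro h
        have := phi_card p
        rw [h] at this; simp at this
      simp [this]
    have h3 : HasSum (fun p => TT y (phi p)) (GG y - 1) := by
      convert h1 using 1
      funext p; exact (h2 p).symm
    have h4 := h3.sigma (fun m => (h3.summable.sigma_factor m).hasSum)
    have h5 := h4.tsum_eq
    simp only [TT_phi, tsum_mul_left] at h5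
    unfold FF
    simp only [hxy]
    rw [h5]; ring
  · intro S hS
    by_cases h0 : S = ∅
    · subst h0; simp [TT_empty]
    · have : ¬ Adm S := fun h => hS (phi_surj S h h0)
      simp [TT, this, h0]

/-- Deletion recursion. -/
lemma GG_rec {y : ℤ → ℂ} (hy : Summable fun k => ‖y k‖) (n : ℤ) :
    GG y = GG (({n} : Set ℤ)ᶜ.indicator y) -
      y n * GG (({n - 1, n, n + 1} : Set ℤ)ᶜ.indicator y) := by
  have ha := hasSum_TT (summable_ind hy ({n} : Set ℤ)ᶜ)
  have hb := (hasSum_TT (summable_ind hy ({n - 1, n, n + 1} : Set ℤ)ᶜ)).mul_left (y n)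
  have hinv : Function.Involutive (fun S : Finset ℤ => symmDiff S {n}) := by
    intro S; simp
  have hb' := (hinv.toPerm.hasSum_iff).mpr hb
  have hs := ha.sub hb'
  rw [← hs.tsum_eq]
  unfold GG
  congr 1
  funext S
  simp only [Function.comp, Function.Involutive.coe_toPerm]
  by_cases hn : n ∈ S
  · rw [TT_zero_of_mem (y := ({n} : Set ℤ)ᶜ.indicator y) hn (by simp), zero_sub]
    have he : symmDiff S {n} = S.erase n := by
      ext a; simp [Finset.mem_symmDiff]
      constructor
      · rintro (h | h)
        · exact ⟨h.2, h.1⟩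
        · exact absurd (h.1 ▸ hn) h.2
      · rintro h; exact Or.inl ⟨h.2, h.1⟩
    rw [he]
    by_cases h1 : n - 1 ∈ S
    · rw [TT_zero_of_mem (S := S.erase n) (k := n - 1) (by simp [h1]) (by simp)]
      have : ¬ Adm S := fun h => h _ h1 (by simpa using hn)
      simp [TT, this]
    by_cases h2 : n + 1 ∈ S
    · rw [TT_zero_of_mem (S := S.erase n) (k := n + 1) (by simp [h2]) (by simp)]
      have : ¬ Adm S := fun h => h _ hn h2
      simp [TT, this]
    have h3 : TT (({n - 1, n, n + 1} : Set ℤ)ᶜ.indicator y) (S.erase n) = TT y (S.erase n) := by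
      apply TT_congr
      intro k hk
      rw [Finset.mem_erase] at hk
      apply Set.indicator_of_mem
      simp only [Set.mem_compl_iff, Set.mem_insert_iff, Set.mem_singleton_iff, not_or]
      exact ⟨fun h => h1 (h ▸ hk.2), hk.1, fun h => h2 (h ▸ hk.2)⟩
    rw [h3]
    have hadm : Adm S ↔ Adm (S.erase n) := by
      constructor
      · intro h k hk hk'
        exact h k (Finset.mem_of_mem_erase hk) (Finset.mem_of_mem_erase hk')
      · intro h k hk hk'
        by_cases hkn : k = n
        · subst hkn; exact h2 hk'
        by_cases hkn' : k + 1 = n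
        · apply h1; convert hk using 1; omega
        exact h k (Finset.mem_erase.mpr ⟨hkn, hk⟩) (Finset.mem_erase.mpr ⟨hkn', hk'⟩)
    unfold TT
    by_cases hA : Adm S
    · rw [if_pos hA, if_pos (hadm.mp hA), ← Finset.mul_prod_erase S _ hn]; ring
    · rw [if_neg hA, if_neg (fun h => hA (hadm.mpr h))]; ring
  · have he : n ∈ symmDiff S {n} := by simp [Finset.mem_symmDiff, hn]
    rw [TT_zero_of_mem he (by simp), mul_zero, sub_zero]
    apply TT_congr
    intro k hk
    rw [Set.indicator_of_mem]
    simp only [Set.mem_compl_iff, Set.mem_singleton_iff]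
    intro h; exact hn (h ▸ hk)

/-- Decoupling. -/
lemma GG_mul {y : ℤ → ℂ} (hy : Summable fun k => ‖y k‖) (n : ℤ) (h0 : y n = 0) :
    GG y = GG ({k | k ≤ n - 1}.indicator y) * GG ({k | n + 1 ≤ k}.indicator y) := by
  set y1 := {k | k ≤ n - 1}.indicator y with hy1
  set y2 := {k | n + 1 ≤ k}.indicator y with hy2
  have s1 : Summable fun k => ‖y1 k‖ := summable_ind hy _
  have s2 : Summable fun k => ‖y2 k‖ := summable_ind hy _
  unfold GG
  rw [tsum_mul_tsum_of_summable_norm (summable_norm_TT s1) (summable_norm_TT s2)]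
  have hinj : Function.Injective
      (fun S : Finset ℤ => (S.filter (· ≤ n), S.filter (fun k => ¬ k ≤ n))) := by
    intro S S' h
    simp only [Prod.mk.injEq] at h
    rw [← Finset.filter_union_filter_not_eq (· ≤ n) S, h.1, h.2,
      Finset.filter_union_filter_not_eq]
  rw [← hinj.tsum_eq]
  · congr 1
    funext S
    simp only
    by_cases hn : n ∈ S
    · rw [TT_zero_of_mem hn h0, TT_zero_of_mem (y := y1) (k := n) (by simp [hn]) (by simp [hy1]),
        zero_mul]
    have e1 : TT y1 (S.filter (· ≤ n)) = TT y (S.filter (· ≤ n)) := by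
      apply TT_congr
      intro k hk
      rw [Finset.mem_filter] at hk
      apply Set.indicator_of_mem
      have : k ≠ n := fun h => hn (h ▸ hk.1)
      have := hk.2
      simp only [Set.mem_ofPred_eq]; omega
    have e2 : TT y2 (S.filter (fun k => ¬ k ≤ n)) = TT y (S.filter (fun k => ¬ k ≤ n)) := by
      apply TT_congr
      intro k hk
      rw [Finset.mem_filter] at hk
      apply Set.indicator_of_mem
      have := hk.2
      simp only [Set.mem_ofPred_eq]; omega
    rw [e1, e2]
    have hadm : Adm S ↔ Adm (S.filter (· ≤ n)) ∧ Adm (S.filter (fun k => ¬ k ≤ n)) := by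
      constructor
      · intro h
        constructor
        · intro k hk hk'
          exact h k (Finset.mem_filter.mp hk).1 (Finset.mem_filter.mp hk').1
        · intro k hk hk'
          exact h k (Finset.mem_filter.mp hk).1 (Finset.mem_filter.mp hk').1
      · rintro ⟨h, h'⟩ k hk hk'
        have hkn : k ≠ n := fun h => hn (h ▸ hk)
        by_cases hle : k ≤ n
        · exact h k (Finset.mem_filter.mpr ⟨hk, hle⟩) (Finset.mem_filter.mpr ⟨hk', by omega⟩)
        · exact h' k (Finset.mem_filter.mpr ⟨hk, hle⟩) (Finset.mem_filter.mpr ⟨hk', by omega⟩)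
    unfold TT
    by_cases hA : Adm S
    · rw [if_pos hA, if_pos (hadm.mp hA).1, if_pos (hadm.mp hA).2,
        Finset.prod_filter_mul_prod_filter_not]
    · rw [if_neg hA]
      by_cases hB : Adm (S.filter (· ≤ n))
      · rw [if_neg (fun h => hA (hadm.mpr ⟨hB, h⟩)), mul_zero]
      · rw [if_neg hB, zero_mul]
  · rintro ⟨S1, S2⟩ hS
    rw [Function.mem_support] at hS
    have c1 : ∀ k ∈ S1, k ≤ n := by
      intro k hk
      by_contra hc
      exact hS (by
        rw [TT_zero_of_mem (y := y1) hk (Set.indicator_of_notMem (by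
          simp only [Set.mem_ofPred_eq]; omega) _), zero_mul])
    have c2 : ∀ k ∈ S2, ¬ k ≤ n := by
      intro k hk hc
      exact hS (by
        rw [TT_zero_of_mem (y := y2) hk (Set.indicator_of_notMem (by
          simp only [Set.mem_ofPred_eq]; omega) _), mul_zero])
    refine ⟨S1 ∪ S2, ?_⟩
    simp only [Prod.mk.injEq]
    constructor
    · ext k
      simp only [Finset.mem_filter, Finset.mem_union]
      have := c1 k
      have := c2 k
      tauto
    · ext k
      simp only [Finset.mem_filter, Finset.mem_union]
      have := c1 k
      have := c2 k
      tauto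

lemma GG_tendsto {y : ℤ → ℂ} (hy : Summable fun k => ‖y k‖) :
    Tendsto (fun n : ℤ => GG ({k | k ≤ n}.indicator y)) atBot (𝓝 1) := by
  have h1 : (∑' S : Finset ℤ, if S = ∅ then (1 : ℂ) else 0) = 1 := tsum_ite_eq ∅ _
  rw [← h1]
  unfold GG
  refine tendsto_tsum_of_dominated_convergence
    (summable_finsetProd_of_summable_nonneg (fun k => norm_nonneg (y k)) hy) ?_ ?_
  · intro S
    by_cases h0 : S = ∅
    · subst h0; simp [TT_empty]
    · rw [if_neg h0]
      obtain ⟨k, hk⟩ := Finset.nonempty_iff_ne_empty.mpr h0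
      apply tendsto_const_nhds.congr'
      filter_upwards [eventually_lt_atBot k] with n hn
      rw [TT_zero_of_mem hk]
      apply Set.indicator_of_notMem
      simp only [Set.mem_ofPred_eq]; omega
  · refine Eventually.of_forall fun n S => norm_TT_le _ _ (fun k => ?_) S
    exact norm_indicator_le_norm_self y k

end Jacobi

namespace Jacobi

lemma hs_congr {ι : Type*} {f g : ι → ℂ} {a : ℂ} (h : HasSum f a) (e : ∀ i, g i = f i) :
    HasSum g a := by
  have : g = f := funext e
  rw [this]; exact h

/-- The products `x_k x_{k+1}`. -/
def YY (lam w : ℤ → ℂ) (u : ℂ) (k : ℤ) : ℂ := w k ^ 2 / ((lam k - u) * (lam (k + 1) - u))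

lemma bound_YY {lam w : ℤ → ℂ} (hconv : ConvCond lam w) {z : ℂ} (hz : z ∈ C0 lam) :
    ∃ δ > 0, ∃ b : ℤ → ℝ, Summable b ∧
      (∀ u ∈ Metric.ball z δ, ∀ k, δ ≤ ‖lam k - u‖) ∧
      (∀ u ∈ Metric.ball z δ, ∀ k, ‖YY lam w u k‖ ≤ b k) := by
  obtain ⟨z₀, hz₀, hsum⟩ := hconv
  have hopen : IsOpen (C0 lam) := isClosed_closure.isOpen_compl
  obtain ⟨ε, hε, hball⟩ := Metric.isOpen_iff.mp hopen z hz
  have hd : ∀ u ∈ Metric.ball z (ε / 2), ∀ k, ε / 2 ≤ ‖lam k - u‖ := by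
    intro u hu k
    by_contra hc
    push Not at hc
    have hmem : lam k ∈ Metric.ball z ε := by
      rw [Metric.mem_ball] at hu ⊢
      have h1 := dist_triangle (lam k) u z
      rw [← dist_eq_norm] at hc
      linarith
    exact hball hmem (subset_closure ⟨k, rfl⟩)
  have hne0 : ∀ k, lam k - z₀ ≠ 0 := by
    intro k h
    apply hz₀
    rw [← sub_eq_zero.mp h]
    exact subset_closure ⟨k, rfl⟩
  set C : ℝ := 1 + (ε / 2 + ‖z - z₀‖) / (ε / 2) with hC
  have hC0 : 0 ≤ C := by positivity
  have hratio : ∀ u ∈ Metric.ball z (ε / 2), ∀ k, ‖lam k - u‖⁻¹ ≤ C * ‖lam k - z₀‖⁻¹ := by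
    intro u hu k
    have h1 := hd u hu k
    have hpos : 0 < ‖lam k - u‖ := by linarith
    have hpos0 : 0 < ‖lam k - z₀‖ := norm_pos_iff.mpr (hne0 k)
    rw [← div_eq_mul_inv, inv_eq_one_div, div_le_div_iff₀ hpos hpos0, one_mul]
    have h2 : ‖lam k - z₀‖ ≤ ‖lam k - u‖ + (‖u - z‖ + ‖z - z₀‖) := by
      have : lam k - z₀ = (lam k - u) + ((u - z) + (z - z₀)) := by ring
      rw [this]
      exact (norm_add_le _ _).trans (by gcongr; exact norm_add_le _ _)
    have h3 : ‖u - z‖ < ε / 2 := by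
      rwa [Metric.mem_ball, dist_eq_norm] at hu
    have h4 : (ε / 2 + ‖z - z₀‖) ≤ (ε / 2 + ‖z - z₀‖) / (ε / 2) * ‖lam k - u‖ := by
      rw [div_mul_eq_mul_div, le_div_iff₀ (by positivity)]
      gcongr
    rw [hC, add_mul, one_mul]
    linarith
  refine ⟨ε / 2, by positivity, _, hsum.mul_left (C ^ 2), hd, ?_⟩
  intro u hu k
  unfold YY
  simp only [norm_mul, div_eq_mul_inv, mul_inv, norm_inv]
  have h1 := hratio u hu k
  have h2 := hratio u hu (k + 1)
  calc ‖w k ^ 2‖ * (‖lam k - u‖⁻¹ * ‖lam (k + 1) - u‖⁻¹)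
      ≤ ‖w k ^ 2‖ * ((C * ‖lam k - z₀‖⁻¹) * (C * ‖lam (k + 1) - z₀‖⁻¹)) := by gcongr
    _ = C ^ 2 * (‖w k ^ 2‖ * (‖lam k - z₀‖⁻¹ * ‖lam (k + 1) - z₀‖⁻¹)) := by ring

lemma hasDerivAt_YY (lam w : ℤ → ℂ) (u : ℂ) (k : ℤ) (h1 : lam k - u ≠ 0)
    (h2 : lam (k + 1) - u ≠ 0) :
    HasDerivAt (fun u => YY lam w u k)
      (YY lam w u k * (1 / (lam k - u) + 1 / (lam (k + 1) - u))) u := by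
  unfold YY
  have a1 : HasDerivAt (fun u => lam k - u) (-1) u := by
    simpa using (hasDerivAt_id u).const_sub (lam k)
  have a2 : HasDerivAt (fun u => lam (k + 1) - u) (-1) u := by
    simpa using (hasDerivAt_id u).const_sub (lam (k + 1))
  have := (hasDerivAt_const u (w k ^ 2)).fun_div (a1.fun_mul a2) (mul_ne_zero h1 h2)
  refine this.congr_deriv ?_
  field_simp
  ring

lemma hasDerivAt_TT (lam w : ℤ → ℂ) (u : ℂ) (h : ∀ k, lam k - u ≠ 0) (S : Finset ℤ) :
    HasDerivAt (fun u => TT (YY lam w u) S)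
      (TT (YY lam w u) S * ∑ k ∈ S, (1 / (lam k - u) + 1 / (lam (k + 1) - u))) u := by
  unfold TT
  split_ifs
  · have := HasDerivAt.fun_finsetProd (u := S) (fun k _ =>
      (hasDerivAt_YY lam w u k (h k) (h (k + 1))).fun_neg)
    refine this.congr_deriv ?_
    rw [Finset.mul_sum]
    symm
    refine Finset.sum_congr rfl fun k hk => ?_
    rw [← Finset.mul_prod_erase S _ hk, smul_eq_mul]
    ring
  · simpa using hasDerivAt_const u (0 : ℂ)

/-- membership indicator -/
def mi (S : Finset ℤ) (n : ℤ) : ℝ := if n ∈ S then 1 else 0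

lemma mi_nonneg (S : Finset ℤ) (n : ℤ) : 0 ≤ mi S n := by unfold mi; split_ifs <;> norm_num

lemma hasSum_mi (S : Finset ℤ) (c : ℤ → ℂ) :
    HasSum (fun n => ((mi S n + mi S (n - 1) : ℝ) : ℂ) * c n) (∑ k ∈ S, (c k + c (k + 1))) := by
  have h1 : HasSum (fun n => ((mi S n : ℝ) : ℂ) * c n) (∑ k ∈ S, c k) := by
    have : HasSum (fun n => ((mi S n : ℝ) : ℂ) * c n) (∑ k ∈ S, ((mi S k : ℝ) : ℂ) * c k) :=
      hasSum_sum_of_ne_finset_zero (fun n hn => by simp [mi, hn])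
    convert this using 1
    exact Finset.sum_congr rfl fun k hk => by simp [mi, hk]
  have h2 : HasSum (fun n => ((mi S (n - 1) : ℝ) : ℂ) * c n) (∑ k ∈ S, c (k + 1)) := by
    rw [← (Equiv.addRight (1 : ℤ)).hasSum_iff]
    have : HasSum (fun n => ((mi S n : ℝ) : ℂ) * c (n + 1))
        (∑ k ∈ S, ((mi S k : ℝ) : ℂ) * c (k + 1)) :=
      hasSum_sum_of_ne_finset_zero (fun n hn => by simp [mi, hn])
    convert this using 1
    · funext n; simp
    · exact Finset.sum_congr rfl fun k hk => by simp [mi, hk]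
  rw [Finset.sum_add_distrib]
  convert h1.add h2 using 1
  funext n; push_cast; ring

lemma TT_diff (y : ℤ → ℂ) (S : Finset ℤ) (n : ℤ) :
    TT y S - TT (({n - 1, n} : Set ℤ)ᶜ.indicator y) S =
      ((mi S n + mi S (n - 1) : ℝ) : ℂ) * TT y S := by
  by_cases hn : n ∈ S
  · rw [TT_zero_of_mem (y := ({n - 1, n} : Set ℤ)ᶜ.indicator y) hn (by simp)]
    by_cases hn' : n - 1 ∈ S
    · have : ¬ Adm S := fun h => h _ hn' (by simpa using hn)
      simp [TT, this]
    · simp [mi, hn, hn']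
  · by_cases hn' : n - 1 ∈ S
    · rw [TT_zero_of_mem (y := ({n - 1, n} : Set ℤ)ᶜ.indicator y) hn' (by simp)]
      simp [mi, hn, hn']
    · rw [TT_congr (y := ({n - 1, n} : Set ℤ)ᶜ.indicator y) (y' := y)]
      · simp [mi, hn, hn']
      · intro k hk
        apply Set.indicator_of_mem
        simp only [Set.mem_compl_iff, Set.mem_insert_iff, Set.mem_singleton_iff, not_or]
        exact ⟨fun h => hn' (h ▸ hk), fun h => hn (h ▸ hk)⟩

lemma summable_Phi {y : ℤ → ℂ} (hy : Summable fun k => ‖y k‖) (c : ℤ → ℂ) (M : ℝ)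
    (hc : ∀ k, ‖c k‖ ≤ M) :
    Summable (fun p : Finset ℤ × ℤ =>
      ((mi p.1 p.2 + mi p.1 (p.2 - 1) : ℝ) : ℂ) * c p.2 * TT y p.1) := by
  have hM : 0 ≤ M := (norm_nonneg _).trans (hc 0)
  have key : Summable (fun p : Finset ℤ × ℤ =>
      (mi p.1 p.2 + mi p.1 (p.2 - 1)) * (M * ‖TT y p.1‖)) := by
    have hs : ∀ S : Finset ℤ, HasSum (fun n => (mi S n + mi S (n - 1)) * (M * ‖TT y S‖))
        (2 * S.card * (M * ‖TT y S‖)) := by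
      intro S
      refine HasSum.mul_right _ ?_
      have := hasSum_mi S (fun _ => 1)
      simp only [mul_one] at this
      rw [← Complex.hasSum_ofReal]
      convert this using 1
      simp; ring
    rw [summable_prod_of_nonneg]
    · refine ⟨fun S => (hs S).summable, ?_⟩
      simp only [(hs _).tsum_eq]
      have h2 : Summable fun S : Finset ℤ => 2 * M * ∏ k ∈ S, (2 * ‖y k‖) :=
        (summable_finsetProd_of_summable_nonneg (fun k => by positivity)
          (hy.mul_left 2)).mul_left _
      refine Summable.of_nonneg_of_le (fun S => by positivity) (fun S => ?_) h2
      rw [Finset.prod_mul_distrib, Finset.prod_const]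
      have h3 := norm_TT_le y _ (fun _ => le_rfl) S
      have h4 : (S.card : ℝ) ≤ 2 ^ S.card := by exact_mod_cast Nat.lt_two_pow_self.le
      calc 2 * (S.card : ℝ) * (M * ‖TT y S‖) = 2 * M * (S.card * ‖TT y S‖) := by ring
        _ ≤ _ := by gcongr
    · intro p
      have := mi_nonneg p.1 p.2
      have := mi_nonneg p.1 (p.2 - 1)
      simp only [Pi.zero_apply]
      positivity
  refine Summable.of_norm_bounded key fun p => ?_
  have h1 := mi_nonneg p.1 p.2
  have h2 := mi_nonneg p.1 (p.2 - 1)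
  rw [norm_mul, norm_mul, Complex.norm_real, Real.norm_of_nonneg (by positivity), mul_assoc]
  gcongr
  exact hc _

lemma hasSum_deriv {lam w : ℤ → ℂ} (hconv : ConvCond lam w) {z : ℂ} (hz : z ∈ C0 lam) :
    HasSum (fun n => (GG (YY lam w z) - GG (({n - 1, n} : Set ℤ)ᶜ.indicator (YY lam w z))) *
      (1 / (lam n - z))) (deriv (fun u => GG (YY lam w u)) z) := by
  obtain ⟨δ, hδ, b, hb, hdist, hbd⟩ := bound_YY hconv hz
  have hzb : z ∈ Metric.ball z δ := Metric.mem_ball_self hδ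
  have hne : ∀ u ∈ Metric.ball z δ, ∀ k, lam k - u ≠ 0 := fun u hu k =>
    norm_pos_iff.mp (hδ.trans_le (hdist u hu k))
  have hb0 : ∀ k, 0 ≤ b k := fun k => (norm_nonneg _).trans (hbd z hzb k)
  have hy : Summable fun k => ‖YY lam w z k‖ :=
    Summable.of_nonneg_of_le (fun _ => norm_nonneg _) (hbd z hzb) hb
  have hd := Complex.hasSum_deriv_of_summable_norm (F := fun S u => TT (YY lam w u) S)
    (summable_finsetProd_of_summable_nonneg hb0 hb)
    (fun S u hu => (hasDerivAt_TT lam w u (hne u hu) S).differentiableAt.differentiableWithinAt)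
    Metric.isOpen_ball (fun S u hu => norm_TT_le _ _ (hbd u hu) S) hzb
  have hP := summable_Phi hy (fun k => 1 / (lam k - z)) (1 / δ) (fun k => by
    rw [norm_div, norm_one]
    exact one_div_le_one_div_of_le hδ (hdist z hzb k))
  have hP1 := hP.hasSum.prod_fiberwise (fun S =>
    (hasSum_mi S (fun k => 1 / (lam k - z))).mul_right (TT (YY lam w z) S))
  have heq : (∑' p : Finset ℤ × ℤ,
      ((mi p.1 p.2 + mi p.1 (p.2 - 1) : ℝ) : ℂ) * (1 / (lam p.2 - z)) * TT (YY lam w z) p.1) =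
      deriv (fun u => GG (YY lam w u)) z := by
    refine hP1.unique ?_
    refine hs_congr hd fun S => ?_
    rw [(hasDerivAt_TT lam w z (hne z hzb) S).deriv, mul_comm]
  rw [← heq]
  refine ((Equiv.prodComm ℤ (Finset ℤ)).hasSum_iff.mpr hP.hasSum).prod_fiberwise fun n => ?_
  have := ((hasSum_TT hy).sub
    (hasSum_TT (summable_ind hy ({n - 1, n} : Set ℤ)ᶜ))).mul_right (1 / (lam n - z))
  refine hs_congr this fun S => ?_
  rw [TT_diff]
  simp only [Function.comp, Equiv.prodComm_apply, Prod.swap]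
  ring

end Jacobi

namespace Jacobi

lemma GG_plus_rec {y : ℤ → ℂ} (hy : Summable fun k => ‖y k‖) (n : ℤ) :
    GG ({k | n ≤ k}.indicator y) =
      GG ({k | n + 1 ≤ k}.indicator y) - y n * GG ({k | n + 2 ≤ k}.indicator y) := by
  rw [GG_rec (summable_ind hy _) n, Set.indicator_indicator, Set.indicator_indicator]
  have e1 : (({n} : Set ℤ)ᶜ ∩ {k | n ≤ k}) = {k | n + 1 ≤ k} := by
    ext k; simp; omega
  have e2 : (({n - 1, n, n + 1} : Set ℤ)ᶜ ∩ {k | n ≤ k}) = {k | n + 2 ≤ k} := by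
    ext k; simp; omega
  rw [e1, e2]
  simp

lemma GG_minus_rec {y : ℤ → ℂ} (hy : Summable fun k => ‖y k‖) (n : ℤ) :
    GG ({k | k ≤ n}.indicator y) =
      GG ({k | k ≤ n - 1}.indicator y) - y n * GG ({k | k ≤ n - 2}.indicator y) := by
  rw [GG_rec (summable_ind hy _) n, Set.indicator_indicator, Set.indicator_indicator]
  have e1 : (({n} : Set ℤ)ᶜ ∩ {k | k ≤ n}) = {k | k ≤ n - 1} := by
    ext k; simp; omega
  have e2 : (({n - 1, n, n + 1} : Set ℤ)ᶜ ∩ {k | k ≤ n}) = {k | k ≤ n - 2} := by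
    ext k; simp; omega
  rw [e1, e2]
  simp

lemma GG_split {y : ℤ → ℂ} (hy : Summable fun k => ‖y k‖) (n : ℤ) :
    GG y = GG ({k | k ≤ n - 1}.indicator y) * GG ({k | n + 1 ≤ k}.indicator y) -
      y n * (GG ({k | k ≤ n - 2}.indicator y) * GG ({k | n + 2 ≤ k}.indicator y)) := by
  rw [GG_rec hy n, GG_mul (summable_ind hy ({n} : Set ℤ)ᶜ) n (by simp),
    GG_mul (summable_ind hy ({n - 1, n, n + 1} : Set ℤ)ᶜ) n (by simp)]
  simp only [Set.indicator_indicator]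
  have e1 : ({k | k ≤ n - 1} ∩ ({n} : Set ℤ)ᶜ) = {k | k ≤ n - 1} := by
    ext k; simp; omega
  have e2 : ({k | n + 1 ≤ k} ∩ ({n} : Set ℤ)ᶜ) = {k | n + 1 ≤ k} := by
    ext k; simp; omega
  have e3 : ({k | k ≤ n - 1} ∩ ({n - 1, n, n + 1} : Set ℤ)ᶜ) = {k | k ≤ n - 2} := by
    ext k; simp; omega
  have e4 : ({k | n + 1 ≤ k} ∩ ({n - 1, n, n + 1} : Set ℤ)ᶜ) = {k | n + 2 ≤ k} := by
    ext k; simp; omega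
  rw [e1, e2, e3, e4]

lemma GG_del {y : ℤ → ℂ} (hy : Summable fun k => ‖y k‖) (n : ℤ) :
    GG (({n - 1, n} : Set ℤ)ᶜ.indicator y) =
      GG ({k | k ≤ n - 2}.indicator y) * GG ({k | n + 1 ≤ k}.indicator y) := by
  rw [GG_mul (summable_ind hy ({n - 1, n} : Set ℤ)ᶜ) n (by simp)]
  simp only [Set.indicator_indicator]
  have e1 : ({k | k ≤ n - 1} ∩ ({n - 1, n} : Set ℤ)ᶜ) = {k | k ≤ n - 2} := by
    ext k; simp; omega
  have e2 : ({k | n + 1 ≤ k} ∩ ({n - 1, n} : Set ℤ)ᶜ) = {k | n + 1 ≤ k} := by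
    ext k; simp; omega
  rw [e1, e2]

lemma YY_eq (lam w γ : ℤ → ℂ) (hγ : ∀ n, γ n * γ (n + 1) = w n) (u : ℂ) (k : ℤ) :
    γ k ^ 2 / (lam k - u) * (γ (k + 1) ^ 2 / (lam (k + 1) - u)) = YY lam w u k := by
  rw [YY, ← hγ, div_mul_div_comm, mul_pow]

lemma charF_eq (lam w γ : ℤ → ℂ) (hγ : ∀ n, γ n * γ (n + 1) = w n) (u : ℂ)
    (hy : Summable fun k => ‖YY lam w u k‖) : charF lam γ u = GG (YY lam w u) := by
  apply FF_eq_GG _ _ _ hy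
  intro k
  rw [← YY_eq lam w γ hγ, ← neg_sub (lam k), ← neg_sub (lam (k + 1)), div_neg, div_neg,
    neg_mul_neg]

lemma Fplus_eq (lam w γ : ℤ → ℂ) (hγ : ∀ n, γ n * γ (n + 1) = w n) (u : ℂ)
    (hy : Summable fun k => ‖YY lam w u k‖) (n : ℤ) :
    Fplus lam γ u n = GG ({k | n ≤ k}.indicator (YY lam w u)) := by
  apply FF_eq_GG _ _ _ (summable_ind hy _)
  intro k
  by_cases h : n ≤ k
  · rw [Set.indicator_of_mem (by simpa using h), Set.indicator_of_mem (by simp; omega),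
      Set.indicator_of_mem (by simpa using h), YY_eq lam w γ hγ]
  · rw [Set.indicator_of_notMem (a := k) (by simpa using h),
      Set.indicator_of_notMem (a := k) (by simpa using h), zero_mul]

lemma Fminus_eq (lam w γ : ℤ → ℂ) (hγ : ∀ n, γ n * γ (n + 1) = w n) (u : ℂ)
    (hy : Summable fun k => ‖YY lam w u k‖) (n : ℤ) :
    Fminus lam γ u n = GG ({k | k ≤ n - 1}.indicator (YY lam w u)) := by
  apply FF_eq_GG _ _ _ (summable_ind hy _)
  intro k
  by_cases h : k + 1 ≤ n
  · rw [Set.indicator_of_mem (by simp; omega), Set.indicator_of_mem (by simpa using h),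
      Set.indicator_of_mem (by simp; omega), YY_eq lam w γ hγ]
  · rw [Set.indicator_of_notMem (a := k + 1) (by simpa using h),
      Set.indicator_of_notMem (a := k) (s := {k | k ≤ n - 1}) (by simp; omega), mul_zero]

lemma Pz_ne (lam w : ℤ → ℂ) (hw : ∀ n, w n ≠ 0) (z : ℂ) (hne : ∀ k, z - lam k ≠ 0) (n : ℤ) :
    Pz lam w z n ≠ 0 := by
  unfold Pz
  split_ifs
  · exact Finset.prod_ne_zero_iff.mpr fun k _ => div_ne_zero (hw _) (hne _)
  · exact Finset.prod_ne_zero_iff.mpr fun k _ => div_ne_zero (hne _) (hw _)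

lemma Pz_rec (lam w : ℤ → ℂ) (hw : ∀ n, w n ≠ 0) (z : ℂ) (hne : ∀ k, z - lam k ≠ 0) (n : ℤ) :
    Pz lam w z (n + 1) * (z - lam (n + 1)) = Pz lam w z n * w n := by
  have h1 := hne (n + 1)
  have h2 := hw n
  unfold Pz
  by_cases h : 0 ≤ n
  · rw [if_pos h, if_pos (by omega)]
    have : Finset.Icc (1 : ℤ) (n + 1) = insert (n + 1) (Finset.Icc 1 n) := by
      ext k; simp; omega
    rw [this, Finset.prod_insert (by simp)]
    simp only [add_sub_cancel_right]
    field_simp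
  · rw [if_neg h]
    have e : Finset.Icc (n + 1) (0 : ℤ) = insert (n + 1) (Finset.Icc (n + 1 + 1) 0) := by
      ext k; simp; omega
    rw [e, Finset.prod_insert (by simp)]
    simp only [add_sub_cancel_right]
    by_cases h' : n = -1
    · subst h'; simp; field_simp
    · rw [if_neg (by omega)]
      field_simp

lemma two_zero (a h : ℤ → ℂ) (ha : ∀ n, a n ≠ 0) (d : ℤ → ℂ)
    (hrec : ∀ n, a (n - 1) * h (n - 1) + a n * h (n + 1) = d n * h n) (n : ℤ)
    (h0 : h n = 0) (h1 : h (n + 1) = 0) (m : ℤ) : h m = 0 := by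
  have key : h m = 0 ∧ h (m + 1) = 0 := by
    induction m using Int.inductionOn' (b := n) with
    | zero => exact ⟨h0, h1⟩
    | succ k _ ih =>
      refine ⟨ih.2, ?_⟩
      have := hrec (k + 1)
      rw [add_sub_cancel_right, ih.1, ih.2, mul_zero, mul_zero, zero_add] at this
      exact (mul_eq_zero.mp this).resolve_left (ha _)
    | pred k _ ih =>
      rw [sub_add_cancel]
      refine ⟨?_, ih.1⟩
      have := hrec k
      rw [ih.1, ih.2, mul_zero, mul_zero, add_zero] at this
      exact (mul_eq_zero.mp this).resolve_left (ha _)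
  exact key.1

end Jacobi

open Jacobi in
/-- the summation formula `∑_{n∈ℤ} f_n(z)² = A(z)·F_𝒥'(z)` at a zero
`z ∈ ℂ₀^λ` of the characteristic function. -/
theorem statement5 (lam w γ : ℤ → ℂ) (hw : ∀ n, w n ≠ 0)
    (hγ : ∀ n, γ n * γ (n + 1) = w n) (hconv : Jacobi.ConvCond lam w)
    (z : ℂ) (hz : z ∈ Jacobi.C0 lam) (hzero : Jacobi.charF lam γ z = 0) :
    (∀ n : ℤ, Jacobi.Fminus lam γ z (n - 1) ≠ 0 ∨ Jacobi.Fminus lam γ z n ≠ 0) ∧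
    ∀ n : ℤ, Jacobi.Fminus lam γ z (n - 1) ≠ 0 →
      HasSum (fun m : ℤ => (Jacobi.fSol₀ lam w γ z m) ^ 2)
        (w (n - 1) * Jacobi.Pz lam w z n * Jacobi.Pz lam w z (n - 1) *
          Jacobi.Fplus lam γ z (n + 1) / Jacobi.Fminus lam γ z (n - 1) *
          deriv (Jacobi.charF lam γ) z) := by
  obtain ⟨δ, hδ, b, hb, hdist, hbd⟩ := bound_YY hconv hz
  have hzb : z ∈ Metric.ball z δ := Metric.mem_ball_self hδ
  have hne' : ∀ k, lam k - z ≠ 0 := fun k => norm_pos_iff.mp (hδ.trans_le (hdist z hzb k))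
  have hne : ∀ k, z - lam k ≠ 0 := fun k => by
    rw [← neg_sub]; exact neg_ne_zero.mpr (hne' k)
  have hyu : ∀ u ∈ Metric.ball z δ, Summable fun k => ‖YY lam w u k‖ := fun u hu =>
    Summable.of_nonneg_of_le (fun _ => norm_nonneg _) (hbd u hu) hb
  have hy := hyu z hzb
  have hderiv : deriv (charF lam γ) z = deriv (fun u => GG (YY lam w u)) z := by
    apply Filter.EventuallyEq.deriv_eq
    filter_upwards [Metric.ball_mem_nhds z hδ] with u hu
    exact charF_eq lam w γ hγ u (hyu u hu)
  have hG : GG (YY lam w z) = 0 := by rw [← charF_eq lam w γ hγ z hy, hzero]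
  set y := YY lam w z with hydef
  have hyv : ∀ k, y k = w k ^ 2 / ((z - lam k) * (z - lam (k + 1))) := by
    intro k
    rw [hydef, YY, ← neg_sub z, ← neg_sub z, neg_mul_neg]
  have hy0 : ∀ k, y k ≠ 0 := fun k => by
    rw [hyv]; exact div_ne_zero (pow_ne_zero _ (hw k)) (mul_ne_zero (hne _) (hne _))
  have hFp := Fplus_eq lam w γ hγ z hy
  have hFm := Fminus_eq lam w γ hγ z hy
  have hFpr : ∀ n, Fplus lam γ z n = Fplus lam γ z (n + 1) - y n * Fplus lam γ z (n + 2) := by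
    intro n; rw [hFp, hFp, hFp]; exact GG_plus_rec hy n
  have hFmr : ∀ n, Fminus lam γ z (n + 1) =
      Fminus lam γ z n - y n * Fminus lam γ z (n - 1) := by
    intro n; rw [hFm, hFm, hFm]
    have := GG_minus_rec hy n
    rw [add_sub_cancel_right, this, show n - 1 - 1 = n - 2 by ring]
  have hWr : ∀ n, Fminus lam γ z n * Fplus lam γ z (n + 1) =
      y n * (Fminus lam γ z (n - 1) * Fplus lam γ z (n + 2)) := by
    intro n
    have := GG_split hy n
    rw [hG, show n - 2 = n - 1 - 1 by ring, ← hFp, ← hFp, ← hFm, ← hFm] at this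
    linear_combination -this
  have part1 : ∀ n : ℤ, Fminus lam γ z (n - 1) ≠ 0 ∨ Fminus lam γ z n ≠ 0 := by
    intro n
    by_contra hcon
    push Not at hcon
    have hall : ∀ m ≤ n, Fminus lam γ z (m - 1) = 0 ∧ Fminus lam γ z m = 0 := by
      intro m hm
      induction m, hm using Int.leInductionDown with
      | base => exact hcon
      | pred m _ ih =>
        refine ⟨?_, ih.1⟩
        have := hFmr (m - 1)
        rw [sub_add_cancel, ih.1, ih.2, zero_sub, eq_comm, neg_eq_zero] at this
        exact (mul_eq_zero.mp this).resolve_left (hy0 _)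
    have ht := GG_tendsto hy
    have ht0 : Tendsto (fun n : ℤ => GG ({k | k ≤ n}.indicator y)) atBot (𝓝 0) := by
      apply tendsto_const_nhds.congr'
      filter_upwards [eventually_le_atBot (n - 1)] with m hm
      have := (hall (m + 1) (by omega)).2
      rw [hFm, add_sub_cancel_right] at this
      exact this.symm
    exact one_ne_zero (tendsto_nhds_unique ht ht0)
  refine ⟨part1, fun n hn => ?_⟩
  have hP := Pz_ne lam w hw z hne
  have hPr := Pz_rec lam w hw z hne
  have hPr' : ∀ m, Pz lam w z (m + 1) = Pz lam w z m * w m / (z - lam (m + 1)) := fun m => by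
    rw [← hPr, mul_div_cancel_right₀ _ (hne _)]
  have hfr : ∀ m, w (m - 1) * fSol₀ lam w γ z (m - 1) + w m * fSol₀ lam w γ z (m + 1) =
      (z - lam m) * fSol₀ lam w γ z m := by
    intro m
    have h1 := hPr (m - 1)
    have h2 := hPr' m
    have h3 := hFpr m
    rw [sub_add_cancel] at h1
    unfold fSol₀
    rw [sub_add_cancel, show m + 1 + 1 = m + 2 by ring, h2, h3, hyv]
    have := hne m
    have := hne (m + 1)
    have e : w (m - 1) * Pz lam w z (m - 1) = Pz lam w z m * (z - lam m) := by
      rw [h1]; ring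
    rw [← mul_assoc, e]
    field_simp
    ring
  have hgr : ∀ m, w (m - 1) * gSol₀ lam w γ z (m - 1) + w m * gSol₀ lam w γ z (m + 1) =
      (z - lam m) * gSol₀ lam w γ z m := by
    intro m
    have h1 := hPr' (m - 1)
    have h2 := hPr' (m - 1 - 1)
    have h3 := hFmr (m - 1)
    rw [sub_add_cancel] at h1 h2 h3
    unfold gSol₀
    rw [add_sub_cancel_right, h3, h1, h2, hyv, sub_add_cancel]
    have := hne m
    have := hne (m - 1)
    have := hP (m - 1 - 1)
    have := hw m
    have := hw (m - 1)
    have := hw (m - 1 - 1)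
    field_simp
    ring
  have hW : ∀ m, fSol₀ lam w γ z m * gSol₀ lam w γ z (m + 1) =
      fSol₀ lam w γ z (m + 1) * gSol₀ lam w γ z m := by
    intro m
    have h1 := hPr' m
    have h2 := hPr' (m - 1)
    rw [sub_add_cancel] at h2
    have h3 := hWr m
    unfold fSol₀ gSol₀
    rw [add_sub_cancel_right, show m + 1 + 1 = m + 2 by ring, h1, h2]
    rw [hyv] at h3
    have := hne m
    have := hne (m + 1)
    have := hP (m - 1)
    have := hw m
    have := hw (m - 1)
    field_simp at h3 ⊢
    linear_combination h3
  set A := w (n - 1) * Pz lam w z n * Pz lam w z (n - 1) *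
          Fplus lam γ z (n + 1) / Fminus lam γ z (n - 1) with hA
  have hgn : gSol₀ lam w γ z n ≠ 0 :=
    mul_ne_zero (inv_ne_zero (mul_ne_zero (hw _) (hP _))) hn
  have hAn : fSol₀ lam w γ z n = A * gSol₀ lam w γ z n := by
    have := hP (n - 1)
    have := hw (n - 1)
    rw [hA]
    unfold fSol₀ gSol₀
    field_simp
  have hAn1 : fSol₀ lam w γ z (n + 1) = A * gSol₀ lam w γ z (n + 1) := by
    apply mul_right_cancel₀ hgn
    rw [← hW, hAn]; ring
  have hAall : ∀ m, fSol₀ lam w γ z m = A * gSol₀ lam w γ z m := by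
    intro m
    rw [← sub_eq_zero]
    refine two_zero w (fun m => fSol₀ lam w γ z m - A * gSol₀ lam w γ z m) hw
      (fun m => z - lam m) ?_ n ?_ ?_ m
    · intro m
      linear_combination hfr m - A * hgr m
    · exact sub_eq_zero.mpr hAn
    · exact sub_eq_zero.mpr hAn1
  have hsum := (hasSum_deriv hconv hz).mul_left A
  rw [hderiv]
  refine hs_congr hsum fun m => ?_
  rw [← hydef, hG, GG_del hy, show m - 2 = m - 1 - 1 by ring, ← hFp, ← hFm, sq]
  nth_rewrite 2 [hAall m]
  have h2 := hPr' (m - 1)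
  rw [sub_add_cancel] at h2
  unfold fSol₀ gSol₀
  rw [h2, ← neg_sub z]
  have := hP (m - 1)
  have := hw (m - 1)
  have := hne m
  field_simp
  ring

end
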